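/- Let ε ≥ 0, d ≥ 1, σ > 0, C2 > 0, and let F : ℝ^d → ℝ^d be a measurable map satisfying ‖F(x_1) − F(x_2)‖ ≤ 2 C2 for all x_1, x_2 ∈ ℝ^d (for instance, F taking values in the closed ball of radius C2). Let K be the Markov kernel K(x) = N(F(x), σ² I_d). Then for all probability measures μ, ν on ℝ^d, E_ε( μK ‖ νK ) ≤ θ_ε(2C2/σ) · E_ε( μ ‖ ν ), where θ_ε(r) := Q(ε/r − r/2) − e^ε Q(ε/r + r/2). -/

import Mathlib

open MeasureTheory Real Finset ENNReal

noncomputable section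

abbrev E (d : ℕ) := EuclideanSpace ℝ (Fin d)

/-- Norm clipping operator `Π_C(x) = x ⬝ min(C/‖x‖, 1)`. -/
def clip {d : ℕ} (C : ℝ) (x : E d) : E d := (min (C / ‖x‖) 1) • x

/-- Gaussian measure `N(m, v I_d)` on `ℝ^d` (with variance `v`), via its density. -/
def gaussian (d : ℕ) (m : E d) (v : ℝ) : Measure (E d) :=
  volume.withDensity fun x =>
    ENNReal.ofReal ((2 * Real.pi * v) ^ (-(d : ℝ) / 2) * Real.exp (-‖x - m‖ ^ 2 / (2 * v)))

/-- Rényi divergence of order `q`. -/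
def renyiDiv {d : ℕ} (q : ℝ) (μ ν : Measure (E d)) : ℝ :=
  (q - 1)⁻¹ * Real.log (∫ x, ((μ.rnDeriv ν x).toReal) ^ q ∂ν)

/-- Hockey-stick divergence `E_ε(μ‖ν) = sup_A (μ(A) − e^ε ν(A))`. -/
def hockeyStick {d : ℕ} (ε : ℝ) (μ ν : Measure (E d)) : ℝ :=
  ⨆ A : {s : Set (E d) // MeasurableSet s},
    ((μ A.1).toReal - Real.exp ε * (ν A.1).toReal)

/-- `∞`-Wasserstein distance. -/
def wInfty {d : ℕ} (μ ν : Measure (E d)) : ℝ≥0∞ :=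
  ⨅ (ω : Measure (E d × E d)) (_ : ω.map Prod.fst = μ) (_ : ω.map Prod.snd = ν),
    essSup (fun p => edist p.1 p.2) ω

/-- Shifted Rényi divergence `D_q^{(z)}(μ‖ν)`. -/
def shiftedRenyi {d : ℕ} (q z : ℝ) (μ ν : Measure (E d)) : ℝ :=
  sInf ((fun μ' => renyiDiv q μ' ν) ''
    {μ' : Measure (E d) | IsProbabilityMeasure μ' ∧ wInfty μ' μ ≤ ENNReal.ofReal z})

/-- Law of the iterates `x_{t+1} = ψ_t(x_t) + ξ_t`, `ξ_t ~ N(0, v_t I_d)`, with `x_0 ~ μ0`. -/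
def lawSeq {d : ℕ} (ψ : ℕ → E d → E d) (v : ℕ → ℝ) (μ0 : Measure (E d)) : ℕ → Measure (E d)
  | 0 => μ0
  | t + 1 => (lawSeq ψ v μ0 t).bind fun x => gaussian d (ψ t x) (v t)

/-- Standard Gaussian tail function `Q`. -/
def gaussQ (t : ℝ) : ℝ := (Real.sqrt (2 * Real.pi))⁻¹ * ∫ u in Set.Ioi t, Real.exp (-u ^ 2 / 2)

/-- Amplification factor `θ_ε(r) = Q(ε/r − r/2) − e^ε Q(ε/r + r/2)`. -/
def theta (ε r : ℝ) : ℝ := gaussQ (ε / r - r / 2) - Real.exp ε * gaussQ (ε / r + r / 2)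

/-- A measurable function with values in `[0, c]` integrates against `μ - M ν` to at most `c` times
the largest value of `μ - M ν` on a measurable set. -/
lemma integral_sub_mul_integral_le {α : Type*} [MeasurableSpace α] (μ ν : Measure α)
    [IsFiniteMeasure μ] [IsFiniteMeasure ν] {M p c : ℝ} (hM : 0 ≤ M)
    (hp : ∀ S, MeasurableSet S → μ.real S - M * ν.real S ≤ p) {g : α → ℝ} (hg : Measurable g)
    (hg0 : ∀ x, 0 ≤ g x) (hgc : ∀ x, g x ≤ c) (hc : 0 ≤ c) :
    ∫ x, g x ∂μ - M * ∫ x, g x ∂ν ≤ c * p := by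
  have hint : ∀ (κ : Measure α) [IsFiniteMeasure κ], Integrable g κ := fun κ _ =>
    Integrable.of_bound hg.aestronglyMeasurable c
      (ae_of_all _ fun x => by rw [Real.norm_of_nonneg (hg0 x)]; exact hgc x)
  obtain ⟨S, hS, hS1, hS2⟩ := hahn_decomposition μ (M.toNNReal • ν)
  have h1 : (M.toNNReal • ν).restrict S ≤ μ.restrict S := by
    refine Measure.le_iff.2 fun t ht => ?_
    rw [Measure.restrict_apply ht, Measure.restrict_apply ht]
    exact hS1 _ (ht.inter hS) Set.inter_subset_right
  have h2 : μ.restrict Sᶜ ≤ (M.toNNReal • ν).restrict Sᶜ := by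
    refine Measure.le_iff.2 fun t ht => ?_
    rw [Measure.restrict_apply ht, Measure.restrict_apply ht]
    exact hS2 _ (ht.inter hS.compl) Set.inter_subset_right
  have hsm : ∀ (T : Set α) (f : α → ℝ),
      ∫ x in T, f x ∂(M.toNNReal • ν) = M * ∫ x in T, f x ∂ν := by
    intro T f
    rw [Measure.restrict_smul, integral_smul_nnreal_measure, NNReal.smul_def,
      Real.coe_toNNReal _ hM, smul_eq_mul]
  have i1 := integral_mono_measure h1 (f := fun x => c - g x)
    (ae_of_all _ fun x => sub_nonneg.2 (hgc x)) ((integrable_const c).sub (hint _))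
  have i2 := integral_mono_measure h2 (f := g) (ae_of_all _ hg0) (hint _)
  rw [hsm] at i1 i2
  rw [integral_sub (integrable_const c) (hint _), integral_sub (integrable_const c) (hint _)] at i1
  simp only [integral_const, smul_eq_mul, measureReal_restrict_apply_univ] at i1
  rw [← integral_add_compl hS (hint μ), ← integral_add_compl hS (hint ν)]
  nlinarith [mul_le_mul_of_nonneg_left (hp S hS) hc]

/-- Neyman-Pearson: a set on which `M ν ≤ μ` and off which `μ ≤ M ν` maximizes `μ - M ν`. -/
lemma measureReal_sub_le_of_setwise_le {α : Type*} [MeasurableSpace α] (μ ν : Measure α)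
    [IsFiniteMeasure μ] [IsFiniteMeasure ν] {M : ℝ} {H A : Set α} (hH : MeasurableSet H)
    (hA : MeasurableSet A)
    (h1 : ∀ t, MeasurableSet t → t ⊆ H → M * ν.real t ≤ μ.real t)
    (h2 : ∀ t, MeasurableSet t → t ⊆ Hᶜ → μ.real t ≤ M * ν.real t) :
    μ.real A - M * ν.real A ≤ μ.real H - M * ν.real H := by
  have e1 := h1 (H \ A) (hH.diff hA) Set.sdiff_subset
  have e2 := h2 (A \ H) (hA.diff hH) fun x hx => hx.2
  have a1 := measureReal_inter_add_sdiff (μ := μ) (s := A) hH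
  have a2 := measureReal_inter_add_sdiff (μ := ν) (s := A) hH
  have b1 := measureReal_inter_add_sdiff (μ := μ) (s := H) hA
  have b2 := measureReal_inter_add_sdiff (μ := ν) (s := H) hA
  rw [Set.inter_comm] at b1 b2
  rw [← a1, ← a2, ← b1, ← b2]
  linarith

lemma measurable_gaussian_density (d : ℕ) (v : ℝ) :
    Measurable fun p : E d × E d => ENNReal.ofReal ((2 * Real.pi * v) ^ (-(d : ℝ) / 2) *
      Real.exp (-‖p.2 - p.1‖ ^ 2 / (2 * v))) := by
  fun_prop

lemma integral_gaussian_density (d : ℕ) (m : E d) {v : ℝ} (hv : 0 < v) :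
    ∫ x, (2 * Real.pi * v) ^ (-(d : ℝ) / 2) * Real.exp (-‖x - m‖ ^ 2 / (2 * v)) = 1 := by
  rw [integral_sub_right_eq_self (fun x : E d => (2 * Real.pi * v) ^ (-(d : ℝ) / 2) *
    Real.exp (-‖x‖ ^ 2 / (2 * v))) m, integral_const_mul]
  have h := GaussianFourier.integral_rexp_neg_mul_sq_norm (V := E d) (b := (2 * v)⁻¹)
    (by positivity)
  have e : ∀ x : E d, -‖x‖ ^ 2 / (2 * v) = -(2 * v)⁻¹ * ‖x‖ ^ 2 := fun x => by ring
  simp_rw [e, h]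
  rw [finrank_euclideanSpace_fin, div_inv_eq_mul, show π * (2 * v) = 2 * π * v by ring,
    ← Real.rpow_add (by positivity)]
  simp [neg_div]

lemma isProbabilityMeasure_gaussian (d : ℕ) (m : E d) {v : ℝ} (hv : 0 < v) :
    IsProbabilityMeasure (gaussian d m v) := by
  constructor
  rw [gaussian, withDensity_apply _ MeasurableSet.univ, Measure.restrict_univ,
    ← ofReal_integral_eq_lintegral_ofReal, integral_gaussian_density d m hv, ENNReal.ofReal_one]
  · exact Integrable.of_integral_ne_zero (by rw [integral_gaussian_density d m hv]; simp)
  · exact ae_of_all _ fun x => by positivity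

lemma charFun_gaussian (d : ℕ) (m : E d) {v : ℝ} (hv : 0 < v) (t : E d) :
    charFun (gaussian d m v) t
      = Complex.exp ((inner ℝ m t : ℝ) * Complex.I - v * ‖t‖ ^ 2 / 2) := by
  rw [charFun_apply, gaussian, integral_withDensity_eq_integral_toReal_smul (by fun_prop)
    (ae_of_all _ fun _ => ENNReal.ofReal_lt_top)]
  rw [← integral_add_right_eq_self _ m]
  have h := GaussianFourier.integral_cexp_neg_mul_sq_norm_add (V := E d)
    (b := ((2 * v)⁻¹ : ℝ)) (by rw [Complex.ofReal_re]; positivity) Complex.I t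
  have hc : (((2 * Real.pi * v) ^ (-(d : ℝ) / 2) : ℝ) : ℂ) *
      ((π : ℂ) / ((2 * v)⁻¹ : ℝ)) ^ ((d : ℂ) / 2) = 1 := by
    have e : ((π : ℂ) / ((2 * v)⁻¹ : ℝ)) ^ ((d : ℂ) / 2)
        = (((2 * π * v) ^ ((d : ℝ) / 2) : ℝ) : ℂ) := by
      rw [Complex.ofReal_cpow (by positivity)]
      push_cast
      congr 1
      field_simp
    rw [e, ← Complex.ofReal_mul, ← Real.rpow_add (by positivity)]
    simp [neg_div]
  have e : ∀ x : E d, (ENNReal.ofReal ((2 * Real.pi * v) ^ (-(d : ℝ) / 2) *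
      Real.exp (-‖x + m - m‖ ^ 2 / (2 * v)))).toReal • Complex.exp (inner ℝ (x + m) t * Complex.I)
      = ((((2 * Real.pi * v) ^ (-(d : ℝ) / 2) : ℝ) : ℂ) *
          Complex.exp ((inner ℝ m t : ℝ) * Complex.I)) *
        Complex.exp (-((2 * v)⁻¹ : ℝ) * ‖x‖ ^ 2 + Complex.I * (inner ℝ t x : ℝ)) := by
    intro x
    rw [ENNReal.toReal_ofReal (by positivity), add_sub_cancel_right, Complex.real_smul,
      Complex.ofReal_mul, mul_assoc ((_ : ℝ) : ℂ), mul_assoc ((_ : ℝ) : ℂ), Complex.ofReal_exp,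
      ← Complex.exp_add, ← Complex.exp_add, inner_add_left, real_inner_comm x t]
    congr 2
    push_cast
    field_simp
    ring
  simp_rw [e]
  rw [integral_const_mul, h, finrank_euclideanSpace_fin]
  rw [mul_right_comm, ← mul_assoc, hc, one_mul, ← Complex.exp_add, add_comm]
  congr 1
  push_cast
  rw [Complex.I_sq]
  field_simp
  ring

lemma gaussian_map_inner (d : ℕ) (m u : E d) (hu : ‖u‖ = 1) {σ : ℝ} (hσ : 0 < σ) :
    (gaussian d m (σ ^ 2)).map (fun x => inner ℝ u x)
      = ProbabilityTheory.gaussianReal (inner ℝ u m) (.mk (σ ^ 2) (sq_nonneg σ)) := by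
  have := isProbabilityMeasure_gaussian d m (pow_pos hσ 2)
  have hm : Measurable fun x : E d => (inner ℝ u x : ℝ) := by fun_prop
  have := Measure.isProbabilityMeasure_map (μ := gaussian d m (σ ^ 2)) hm.aemeasurable
  refine Measure.ext_of_charFun (funext fun s => ?_)
  rw [ProbabilityTheory.charFun_gaussianReal, charFun_apply_real,
    integral_map hm.aemeasurable (by fun_prop)]
  have h := charFun_gaussian d m (pow_pos hσ 2) (s • u)
  rw [charFun_apply] at h
  simp_rw [inner_smul_right, real_inner_comm u, Complex.ofReal_mul] at h
  rw [h, norm_smul, hu]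
  congr 1
  have e : (((|s| : ℝ)) : ℂ) ^ 2 = (s : ℂ) ^ 2 := by
    rw [← Complex.ofReal_pow, sq_abs, Complex.ofReal_pow]
  simp [e]

lemma gaussianReal_real_Ioi (m : ℝ) {σ : ℝ} (hσ : 0 < σ) (c : ℝ) :
    (ProbabilityTheory.gaussianReal m (.mk (σ ^ 2) (sq_nonneg σ))).real (Set.Ioi c)
      = gaussQ ((c - m) / σ) := by
  have h : ProbabilityTheory.gaussianReal m (.mk (σ ^ 2) (sq_nonneg σ))
      = ((ProbabilityTheory.gaussianReal 0 1).map (σ * ·)).map (m + ·) := by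
    rw [ProbabilityTheory.gaussianReal_map_const_mul,
      ProbabilityTheory.gaussianReal_map_const_add]
    simp
  rw [h, Measure.map_map (by fun_prop) (by fun_prop),
    map_measureReal_apply (by fun_prop) measurableSet_Ioi]
  have hs : ((m + ·) ∘ (σ * ·)) ⁻¹' Set.Ioi c = Set.Ioi ((c - m) / σ) := by
    ext x
    simp only [Set.mem_preimage, Function.comp, Set.mem_Ioi, div_lt_iff₀ hσ]
    constructor <;> intro <;> linarith
  rw [hs, measureReal_def, ProbabilityTheory.gaussianReal_apply_eq_integral _ one_ne_zero,
    ENNReal.toReal_ofReal (integral_nonneg fun x =>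
      ProbabilityTheory.gaussianPDFReal_nonneg _ _ _), gaussQ, ← integral_const_mul]
  simp [ProbabilityTheory.gaussianPDFReal]

lemma gaussian_real_halfspace (d : ℕ) (m u : E d) (hu : ‖u‖ = 1) {σ : ℝ} (hσ : 0 < σ) (c : ℝ) :
    (gaussian d m (σ ^ 2)).real {x | c < inner ℝ u x} = gaussQ ((c - inner ℝ u m) / σ) := by
  rw [← gaussianReal_real_Ioi _ hσ, ← gaussian_map_inner d m u hu hσ,
    map_measureReal_apply (by fun_prop) measurableSet_Ioi]
  rfl

/-- If the density ratio is ordered on `t`, so are the Gaussian masses. -/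
lemma gaussian_real_le_of_forall_mem (d : ℕ) (a b : E d) {v k : ℝ} (hv : 0 < v) {t : Set (E d)}
    (ht : MeasurableSet t) (h : ∀ x ∈ t, k - ‖x - b‖ ^ 2 / (2 * v) ≤ -‖x - a‖ ^ 2 / (2 * v)) :
    Real.exp k * (gaussian d b v).real t ≤ (gaussian d a v).real t := by
  have := isProbabilityMeasure_gaussian d a hv
  have hle : ENNReal.ofReal (Real.exp k) * gaussian d b v t ≤ gaussian d a v t := by
    rw [gaussian, gaussian, withDensity_apply _ ht, withDensity_apply _ ht,
      ← lintegral_const_mul _ (by fun_prop)]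
    refine setLIntegral_mono (by fun_prop) fun x hx => ?_
    rw [← ENNReal.ofReal_mul (Real.exp_nonneg k)]
    refine ENNReal.ofReal_le_ofReal ?_
    rw [mul_left_comm, ← Real.exp_add]
    gcongr
    have := h x hx
    rw [neg_div (2 * v) (‖x - b‖ ^ 2)]
    linarith
  have := ENNReal.toReal_mono (measure_ne_top _ _) hle
  rwa [ENNReal.toReal_mul, ENNReal.toReal_ofReal (Real.exp_nonneg k)] at this

/-- The hockey-stick divergence of two distinct isotropic Gaussians is at most `θ_ε`. -/
lemma gaussian_real_sub_le_theta_of_ne (d : ℕ) (ε : ℝ) {σ : ℝ} (hσ : 0 < σ) {a b : E d}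
    (hab : a ≠ b) {A : Set (E d)} (hA : MeasurableSet A) :
    (gaussian d a (σ ^ 2)).real A - Real.exp ε * (gaussian d b (σ ^ 2)).real A
      ≤ theta ε (‖a - b‖ / σ) := by
  have hv : 0 < σ ^ 2 := pow_pos hσ 2
  have := isProbabilityMeasure_gaussian d a hv
  have := isProbabilityMeasure_gaussian d b hv
  set D := ‖a - b‖ with hD
  have hD0 : 0 < D := norm_pos_iff.2 (sub_ne_zero.2 hab)
  set u : E d := D⁻¹ • (a - b) with hu
  have hu1 : ‖u‖ = 1 := by
    rw [hu, norm_smul, norm_inv, norm_norm, ← hD, inv_mul_cancel₀ hD0.ne']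
  set c : ℝ := (2 * σ ^ 2 * ε + ‖a‖ ^ 2 - ‖b‖ ^ 2) / (2 * D) with hc
  have hux : ∀ x : E d, inner ℝ u x = (inner ℝ a x - inner ℝ b x) / D := by
    intro x
    rw [hu, real_inner_smul_left, inner_sub_left]
    ring
  have hsq : ∀ x : E d, ‖x - b‖ ^ 2 - ‖x - a‖ ^ 2
      = 2 * (inner ℝ a x - inner ℝ b x) + ‖b‖ ^ 2 - ‖a‖ ^ 2 := by
    intro x
    rw [norm_sub_sq_real, norm_sub_sq_real, real_inner_comm x a, real_inner_comm x b]
    ring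
  have hD2 : D ^ 2 = ‖a‖ ^ 2 - 2 * inner ℝ a b + ‖b‖ ^ 2 := norm_sub_sq_real a b
  have hmem : ∀ x : E d, c < inner ℝ u x ↔ 2 * σ ^ 2 * ε < ‖x - b‖ ^ 2 - ‖x - a‖ ^ 2 := by
    intro x
    rw [hsq, hux, hc, div_lt_div_iff₀ (by positivity) hD0]
    constructor
    · intro h
      have : D * (2 * σ ^ 2 * ε + ‖a‖ ^ 2 - ‖b‖ ^ 2) <
        D * (2 * (inner ℝ a x - inner ℝ b x)) := by linarith
      linarith [lt_of_mul_lt_mul_left this hD0.le]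
    · intro h
      nlinarith
  have hH : MeasurableSet {x : E d | c < inner ℝ u x} :=
    measurableSet_lt measurable_const (by fun_prop)
  refine (measureReal_sub_le_of_setwise_le _ _ hH hA ?_ ?_).trans ?_
  · intro t ht htH
    refine gaussian_real_le_of_forall_mem d a b hv ht fun x hx => ?_
    have := (hmem x).1 (htH hx)
    rw [← sub_nonneg]
    have e : -‖x - a‖ ^ 2 / (2 * σ ^ 2) - (ε - ‖x - b‖ ^ 2 / (2 * σ ^ 2))
      = (‖x - b‖ ^ 2 - ‖x - a‖ ^ 2 - 2 * σ ^ 2 * ε) / (2 * σ ^ 2) := by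
      field_simp
      ring
    rw [e]
    exact div_nonneg (by linarith) (by positivity)
  · intro t ht htH
    have key := gaussian_real_le_of_forall_mem d b a (k := -ε) hv ht fun x hx => by
      have := not_lt.1 (mt (hmem x).2 (htH hx))
      rw [← sub_nonneg]
      have e : -‖x - b‖ ^ 2 / (2 * σ ^ 2) - (-ε - ‖x - a‖ ^ 2 / (2 * σ ^ 2))
        = (2 * σ ^ 2 * ε - (‖x - b‖ ^ 2 - ‖x - a‖ ^ 2)) / (2 * σ ^ 2) := by
        field_simp
        ring
      rw [e]
      exact div_nonneg (by linarith) (by positivity)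
    have := mul_le_mul_of_nonneg_left key (Real.exp_nonneg ε)
    rwa [← mul_assoc, ← Real.exp_add, add_neg_cancel, Real.exp_zero, one_mul] at this
  · rw [gaussian_real_halfspace d a u hu1 hσ, gaussian_real_halfspace d b u hu1 hσ, theta]
    have e1 : (c - inner ℝ u a) / σ = ε / (D / σ) - D / σ / 2 := by
      rw [hux, hc, real_inner_self_eq_norm_sq, real_inner_comm]
      field_simp
      linear_combination hD2
    have e2 : (c - inner ℝ u b) / σ = ε / (D / σ) + D / σ / 2 := by
      rw [hux, hc, real_inner_self_eq_norm_sq]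
      field_simp
      linear_combination (-1 : ℝ) * hD2
    rw [e1, e2]

lemma gaussQ_antitone : Antitone gaussQ := by
  intro s t hst
  have h : ∀ r, gaussQ r = (ProbabilityTheory.gaussianReal 0 (.mk (1 ^ 2) (sq_nonneg 1))).real
      (Set.Ioi r) := fun r => by rw [gaussianReal_real_Ioi 0 one_pos r]; simp
  rw [h, h]
  exact measureReal_mono (Set.Ioi_subset_Ioi hst)

/-- Comparing the tails of two unit-variance Gaussians at distance `R`. -/
lemma gaussQ_sub_le_theta (ε : ℝ) {R : ℝ} (hR : 0 < R) (t : ℝ) :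
    gaussQ t - Real.exp ε * gaussQ (t + R) ≤ theta ε R := by
  let e : E 1 := EuclideanSpace.single 0 1
  have he : ‖e‖ = 1 := by simp [e]
  have hRe : ‖R • e - 0‖ = R := by rw [sub_zero, norm_smul, he, Real.norm_of_nonneg hR.le, mul_one]
  have hne : R • e ≠ 0 := by
    rw [← norm_pos_iff, ← sub_zero (R • e), hRe]; exact hR
  have h := gaussian_real_sub_le_theta_of_ne 1 ε one_pos hne
    (A := {x | t + R < inner ℝ e x}) (measurableSet_lt measurable_const (by fun_prop))
  rw [gaussian_real_halfspace 1 _ e he one_pos, gaussian_real_halfspace 1 _ e he one_pos, hRe,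
    real_inner_smul_right, real_inner_self_eq_norm_sq, he, inner_zero_right] at h
  simpa using h

lemma theta_nonneg (ε : ℝ) {R : ℝ} (hR : 0 < R) : 0 ≤ theta ε R := by
  let e : E 1 := EuclideanSpace.single 0 1
  have he : ‖e‖ = 1 := by simp [e]
  have hRe : ‖R • e - 0‖ = R := by rw [sub_zero, norm_smul, he, Real.norm_of_nonneg hR.le, mul_one]
  have hne : R • e ≠ 0 := by
    rw [← norm_pos_iff, ← sub_zero (R • e), hRe]; exact hR
  have h := gaussian_real_sub_le_theta_of_ne 1 ε one_pos hne MeasurableSet.empty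
  rw [hRe] at h
  simpa using h

lemma theta_le_theta (ε : ℝ) {r R : ℝ} (hr : 0 < r) (hrR : r ≤ R) : theta ε r ≤ theta ε R := by
  refine le_trans ?_ (gaussQ_sub_le_theta ε (hr.trans_le hrR) (ε / r - r / 2))
  rw [theta]
  gcongr
  apply gaussQ_antitone
  linarith

lemma gaussian_real_sub_le_theta (d : ℕ) {ε : ℝ} (hε : 0 ≤ ε) {σ r : ℝ} (hσ : 0 < σ) (hr : 0 < r)
    {a b : E d} (hab : ‖a - b‖ ≤ r) {A : Set (E d)} (hA : MeasurableSet A) :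
    (gaussian d a (σ ^ 2)).real A - Real.exp ε * (gaussian d b (σ ^ 2)).real A
      ≤ theta ε (r / σ) := by
  rcases eq_or_ne a b with rfl | h
  · refine le_trans ?_ (theta_nonneg ε (div_pos hr hσ))
    nlinarith [Real.one_le_exp hε, measureReal_nonneg (μ := gaussian d a (σ ^ 2)) (s := A)]
  · refine (gaussian_real_sub_le_theta_of_ne d ε hσ h hA).trans (theta_le_theta ε ?_ ?_)
    · exact div_pos (norm_pos_iff.2 (sub_ne_zero.2 h)) hσ
    · gcongr

lemma measurable_gaussian_comp {d : ℕ} {F : E d → E d} (hF : Measurable F) (v : ℝ) :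
    Measurable fun x => gaussian d (F x) v := by
  refine Measure.measurable_of_measurable_coe _ fun s hs => ?_
  simp_rw [gaussian, withDensity_apply _ hs]
  exact Measurable.lintegral_prod_right'
    (f := fun p : E d × E d => ENNReal.ofReal ((2 * Real.pi * v) ^ (-(d : ℝ) / 2) *
      Real.exp (-‖p.2 - F p.1‖ ^ 2 / (2 * v)))) (by fun_prop)

lemma sub_le_hockeyStick {d : ℕ} (ε : ℝ) (μ ν : Measure (E d)) [IsProbabilityMeasure μ]
    {S : Set (E d)} (hS : MeasurableSet S) :
    μ.real S - Real.exp ε * ν.real S ≤ hockeyStick ε μ ν := by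
  refine le_ciSup (f := fun A : {s : Set (E d) // MeasurableSet s} =>
    ((μ A.1).toReal - Real.exp ε * (ν A.1).toReal)) ⟨1, ?_⟩ ⟨S, hS⟩
  rintro _ ⟨A, rfl⟩
  have h1 : μ.real A.1 ≤ 1 := measureReal_le_one
  have h2 : 0 ≤ Real.exp ε * ν.real A.1 := by positivity
  change μ.real A.1 - Real.exp ε * ν.real A.1 ≤ 1
  linarith

lemma hockeyStick_le_one {d : ℕ} (ε : ℝ) (μ ν : Measure (E d)) [IsProbabilityMeasure μ] :
    hockeyStick ε μ ν ≤ 1 := by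
  have : Nonempty {s : Set (E d) // MeasurableSet s} := ⟨⟨∅, MeasurableSet.empty⟩⟩
  refine ciSup_le fun A => ?_
  have h1 : μ.real A.1 ≤ 1 := measureReal_le_one
  have h2 : 0 ≤ Real.exp ε * ν.real A.1 := by positivity
  change μ.real A.1 - Real.exp ε * ν.real A.1 ≤ 1
  linarith

/-- A function with values in `[0, 1]` whose values satisfy `f x - e^ε f y ≤ θ` contracts the
hockey-stick divergence by `θ`. -/
lemma integral_sub_le_mul_hockeyStick {d : ℕ} {ε θ : ℝ} (hε : 0 ≤ ε) (μ ν : Measure (E d))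
    [IsProbabilityMeasure μ] [IsProbabilityMeasure ν] {f : E d → ℝ} (hf : Measurable f)
    (hf0 : ∀ x, 0 ≤ f x) (hf1 : ∀ x, f x ≤ 1) (hθ : ∀ x y, f x - Real.exp ε * f y ≤ θ) :
    ∫ x, f x ∂μ - Real.exp ε * ∫ x, f x ∂ν ≤ θ * hockeyStick ε μ ν := by
  have hM : 1 ≤ Real.exp ε := Real.one_le_exp hε
  set M := Real.exp ε
  set p := hockeyStick ε μ ν
  have hp1 : p ≤ 1 := hockeyStick_le_one ε μ ν
  have hp0 : 0 ≤ p := by simpa using sub_le_hockeyStick ε μ ν MeasurableSet.empty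
  have hbb : BddBelow (Set.range f) := ⟨0, by rintro _ ⟨x, rfl⟩; exact hf0 x⟩
  set i := ⨅ x, f x
  have hi : ∀ x, i ≤ f x := fun x => ciInf_le hbb x
  have hi0 : 0 ≤ i := le_ciInf hf0
  have hs : ∀ x, f x ≤ θ + M * i := by
    intro x
    have : (f x - θ) / M ≤ i := le_ciInf fun y => by
      rw [div_le_iff₀ (by linarith)]
      linarith [hθ x y]
    rw [div_le_iff₀ (by linarith)] at this
    linarith
  have hint : ∀ (κ : Measure (E d)) [IsProbabilityMeasure κ], Integrable f κ := fun κ _ =>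
    Integrable.of_bound hf.aestronglyMeasurable 1
      (ae_of_all _ fun x => by rw [Real.norm_of_nonneg (hf0 x)]; exact hf1 x)
  have key := integral_sub_mul_integral_le μ ν (M := M) (p := p) (c := θ + M * i - i)
    (g := fun x => f x - i) (by linarith) (fun S hS => sub_le_hockeyStick ε μ ν hS)
    (hf.sub_const i) (fun x => sub_nonneg.2 (hi x)) (fun x => sub_le_sub_right (hs x) i)
    (by linarith [hi 0, hs 0])
  rw [integral_sub (hint μ) (integrable_const i), integral_sub (hint ν) (integrable_const i)] at key
  simp only [integral_const, probReal_univ, one_smul] at key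
  nlinarith [mul_nonneg hi0 (mul_nonneg (sub_nonneg.2 hM) (sub_nonneg.2 hp1))]

/-- Per-iteration hockey-stick contraction for a Gaussian kernel centered at `F(x)`,
where `F` has diameter at most `2C2`. -/
theorem stmt16 {d : ℕ} (hd : 1 ≤ d) (ε : ℝ) (hε : 0 ≤ ε) (σ C2 : ℝ) (hσ : 0 < σ)
    (hC2 : 0 < C2) (F : E d → E d) (hFm : Measurable F)
    (hF : ∀ x1 x2 : E d, ‖F x1 - F x2‖ ≤ 2 * C2)
    (μ ν : Measure (E d)) [IsProbabilityMeasure μ] [IsProbabilityMeasure ν] :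
    hockeyStick ε (μ.bind fun x => gaussian d (F x) (σ ^ 2))
        (ν.bind fun x => gaussian d (F x) (σ ^ 2))
      ≤ theta ε (2 * C2 / σ) * hockeyStick ε μ ν := by
  have hv : 0 < σ ^ 2 := pow_pos hσ 2
  have hK := measurable_gaussian_comp hFm (σ ^ 2)
  have hP : ∀ x, IsProbabilityMeasure (gaussian d (F x) (σ ^ 2)) := fun x =>
    isProbabilityMeasure_gaussian d (F x) hv
  have : Nonempty {s : Set (E d) // MeasurableSet s} := ⟨⟨∅, MeasurableSet.empty⟩⟩
  refine ciSup_le fun ⟨A, hA⟩ => ?_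
  have hbind : ∀ κ : Measure (E d), (κ.bind (fun x => gaussian d (F x) (σ ^ 2)) A).toReal
      = ∫ x, (gaussian d (F x) (σ ^ 2)).real A ∂κ := by
    intro κ
    rw [Measure.bind_apply hA hK.aemeasurable]
    exact (integral_toReal ((Measure.measurable_coe hA).comp hK).aemeasurable
      (ae_of_all _ fun x => measure_lt_top _ _)).symm
  rw [hbind, hbind]
  exact integral_sub_le_mul_hockeyStick hε μ ν
    ((Measure.measurable_coe hA).comp hK).ennreal_toReal
    (fun x => measureReal_nonneg) (fun x => measureReal_le_one)
    fun x y => gaussian_real_sub_le_theta d hε hσ (by positivity) (hF x y) hA
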